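/- Let n, d, c be positive integers, X ∈ ℝ^{d×n}, γ ≥ 0, ρ > 0, C > 0, λ₁ ∈ ℝ^{n×c}, λ₂ ∈ ℝ^{d×c}, and fix U, Y ∈ ℝ^{n×c}, V, W⁰ ∈ ℝ^{d×c}. Set a := 2γ + ρ + C and Z := Xλ₁ + λ₂ + ρXY − ρXU + ρV + C·W⁰. Then the matrix I_n + (ρ/a)·XᵀX is invertible, and the function φ(W) := γ‖W‖_F² + ⟨λ₁, Y − XᵀW − U⟩ + ⟨λ₂, V − W⟩ + (ρ/2)·(‖Y − XᵀW − U‖_F² + ‖V − W‖_F²) + (C/2)‖W − W⁰‖_F² has a unique minimizer over ℝ^{d×c}, given by W* = ( (1/a)·I_d − (ρ/a²)·X·(I_n + (ρ/a)·XᵀX)^{−1}·Xᵀ )·Z. -/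

import Mathlib

open Matrix BigOperators

/-- Squared Frobenius norm ‖A‖_F² = Tr(AᵀA). -/
noncomputable def frobSq {m k : Type*} [Fintype m] [Fintype k] (A : Matrix m k ℝ) : ℝ :=
  ∑ i, ∑ j, (A i j) ^ 2

/-- Trace inner product ⟨A,B⟩ = Tr(AᵀB). -/
noncomputable def finner {m k : Type*} [Fintype m] [Fintype k] (A B : Matrix m k ℝ) : ℝ :=
  ∑ i, ∑ j, (A i j) * (B i j)

section FrobeniusInner

variable {m k l : Type*} [Fintype m] [Fintype k] [Fintype l]

theorem finner_eq_trace (A B : Matrix m k ℝ) : finner A B = (Aᵀ * B).trace := by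
  simp only [finner, Matrix.trace, Matrix.diag, Matrix.mul_apply, Matrix.transpose_apply]
  exact Finset.sum_comm

theorem finner_add_left (A B D : Matrix m k ℝ) :
    finner (A + B) D = finner A D + finner B D := by
  simp only [finner_eq_trace, transpose_add, Matrix.add_mul, trace_add]

theorem finner_sub_left (A B D : Matrix m k ℝ) :
    finner (A - B) D = finner A D - finner B D := by
  simp only [finner_eq_trace, transpose_sub, Matrix.sub_mul, trace_sub]

theorem finner_smul_left (r : ℝ) (A D : Matrix m k ℝ) :
    finner (r • A) D = r * finner A D := by
  simp only [finner_eq_trace, transpose_smul, Matrix.smul_mul, trace_smul, smul_eq_mul]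

theorem finner_sub_right (D A B : Matrix m k ℝ) :
    finner D (A - B) = finner D A - finner D B := by
  simp only [finner_eq_trace, Matrix.mul_sub, trace_sub]

theorem finner_mul_left (X : Matrix m l ℝ) (A : Matrix l k ℝ) (D : Matrix m k ℝ) :
    finner (X * A) D = finner A (Xᵀ * D) := by
  simp only [finner_eq_trace, transpose_mul, Matrix.mul_assoc]

theorem frobSq_add (A D : Matrix m k ℝ) :
    frobSq (A + D) = frobSq A + 2 * finner A D + frobSq D := by
  simp only [frobSq, finner, Finset.mul_sum, ← Finset.sum_add_distrib, Matrix.add_apply]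
  exact Finset.sum_congr rfl fun i _ => Finset.sum_congr rfl fun j _ => by ring

theorem frobSq_sub (A D : Matrix m k ℝ) :
    frobSq (A - D) = frobSq A - 2 * finner A D + frobSq D := by
  simp only [frobSq, finner, Finset.mul_sum, ← Finset.sum_add_distrib,
    ← Finset.sum_sub_distrib, Matrix.sub_apply]
  exact Finset.sum_congr rfl fun i _ => Finset.sum_congr rfl fun j _ => by ring

theorem frobSq_nonneg (A : Matrix m k ℝ) : 0 ≤ frobSq A :=
  Finset.sum_nonneg fun _ _ => Finset.sum_nonneg fun _ _ => sq_nonneg _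

theorem eq_zero_of_frobSq_nonpos {A : Matrix m k ℝ} (h : frobSq A ≤ 0) : A = 0 := by
  have hrow : ∀ i, 0 ≤ ∑ j, A i j ^ 2 := fun i => Finset.sum_nonneg fun _ _ => sq_nonneg _
  have h0 : ∑ i, ∑ j, A i j ^ 2 = 0 := le_antisymm h (frobSq_nonneg A)
  ext i j
  have hi := (Finset.sum_eq_zero_iff_of_nonneg fun i _ => hrow i).mp h0 i (Finset.mem_univ i)
  have hj := (Finset.sum_eq_zero_iff_of_nonneg fun j _ => sq_nonneg (A i j)).mp hi j
    (Finset.mem_univ j)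
  exact (pow_eq_zero_iff two_ne_zero).mp hj

end FrobeniusInner

section Woodbury

variable {m k l : Type*} [Fintype m] [Fintype k] [DecidableEq k]

theorem isUnit_one_add_smul_transpose_mul_self (X : Matrix m k ℝ) {t : ℝ} (ht : 0 ≤ t) :
    IsUnit ((1 : Matrix k k ℝ) + t • (Xᵀ * X)) := by
  have h : (Xᵀ * X).PosSemidef := by
    simpa [conjTranspose_eq_transpose_of_trivial] using posSemidef_conjTranspose_mul_self X
  exact (PosDef.one.add_posSemidef (h.smul ht)).isUnit

/-- The Sherman–Morrison–Woodbury formula solves `(a I + ρ X Xᵀ) S = Z`. -/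
theorem woodbury_solution [DecidableEq m] (X : Matrix m k ℝ) (Z : Matrix m l ℝ) {a ρ : ℝ} (ha : a ≠ 0)
    (hU : IsUnit ((1 : Matrix k k ℝ) + (ρ / a) • (Xᵀ * X))) :
    let S := ((1 / a) • (1 : Matrix m m ℝ)
      - (ρ / a ^ 2) • (X * ((1 : Matrix k k ℝ) + (ρ / a) • (Xᵀ * X))⁻¹ * Xᵀ)) * Z
    a • S + ρ • (X * (Xᵀ * S)) = Z := by
  intro S
  have hG := mul_nonsing_inv _ ((isUnit_iff_isUnit_det _).mp hU)
  set G := ((1 : Matrix k k ℝ) + (ρ / a) • (Xᵀ * X))⁻¹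
  have hS : S = (1 / a) • Z - (ρ / a ^ 2) • (X * (G * (Xᵀ * Z))) := by
    simp only [S, G, Matrix.sub_mul, Matrix.smul_mul, Matrix.one_mul, Matrix.mul_assoc]
  have hQ : X * (G * (Xᵀ * Z)) + (ρ / a) • (X * (Xᵀ * (X * (G * (Xᵀ * Z))))) = X * (Xᵀ * Z) := by
    have h := congrArg (fun T => X * (T * (Xᵀ * Z))) hG
    simpa only [Matrix.add_mul, Matrix.mul_add, Matrix.smul_mul, Matrix.mul_smul,
      Matrix.one_mul, Matrix.mul_assoc] using h
  rw [hS]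
  simp only [Matrix.mul_sub, Matrix.mul_smul]
  rw [← hQ]
  match_scalars <;> field_simp <;> ring

end Woodbury

/-- Closed-form solution of the W-subproblem (a) of the PAM method. -/
theorem stmt_5 (n d c : ℕ) (hn : 0 < n) (hd : 0 < d) (hc : 0 < c)
    (X : Matrix (Fin d) (Fin n) ℝ) (γ ρ C : ℝ) (hγ : 0 ≤ γ) (hρ : 0 < ρ) (hC : 0 < C)
    (lam1 : Matrix (Fin n) (Fin c) ℝ) (lam2 : Matrix (Fin d) (Fin c) ℝ)
    (U Y : Matrix (Fin n) (Fin c) ℝ) (V W0 : Matrix (Fin d) (Fin c) ℝ)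
    (a : ℝ) (ha : a = 2 * γ + ρ + C)
    (Z : Matrix (Fin d) (Fin c) ℝ)
    (hZ : Z = X * lam1 + lam2 + ρ • (X * Y) - ρ • (X * U) + ρ • V + C • W0)
    (φ : Matrix (Fin d) (Fin c) ℝ → ℝ)
    (hφ : ∀ W, φ W = γ * frobSq W + finner lam1 (Y - Xᵀ * W - U) + finner lam2 (V - W)
      + (ρ / 2) * (frobSq (Y - Xᵀ * W - U) + frobSq (V - W)) + (C / 2) * frobSq (W - W0)) :
    IsUnit ((1 : Matrix (Fin n) (Fin n) ℝ) + (ρ / a) • (Xᵀ * X)) ∧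
    (let Wstar : Matrix (Fin d) (Fin c) ℝ :=
        ((1 / a) • (1 : Matrix (Fin d) (Fin d) ℝ)
          - (ρ / a ^ 2) • (X * ((1 : Matrix (Fin n) (Fin n) ℝ) + (ρ / a) • (Xᵀ * X))⁻¹ * Xᵀ)) * Z;
      (∀ W, φ Wstar ≤ φ W) ∧ ∀ W, (∀ W', φ W ≤ φ W') → W = Wstar) := by
  have ha0 : 0 < a := by rw [ha]; positivity
  have hU := isUnit_one_add_smul_transpose_mul_self X (div_nonneg hρ.le ha0.le)
  refine ⟨hU, ?_⟩
  intro S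
  have hS : a • S + ρ • (X * (Xᵀ * S)) = Z := woodbury_solution X Z ha0.ne' hU
  have key : ∀ D, φ (S + D) = φ S + a / 2 * frobSq D + ρ / 2 * frobSq (Xᵀ * D) := by
    intro D
    have h := congrArg (fun T => finner T D) (hS.trans hZ)
    simp only [finner_add_left, finner_sub_left, finner_smul_left, finner_mul_left] at h
    have e1 : Y - Xᵀ * (S + D) - U = (Y - Xᵀ * S - U) - Xᵀ * D := by
      rw [Matrix.mul_add]; abel
    have e2 : V - (S + D) = (V - S) - D := by abel
    have e3 : S + D - W0 = (S - W0) + D := by abel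
    rw [hφ, hφ, e1, e2, e3, frobSq_sub (Y - Xᵀ * S - U), frobSq_sub (V - S),
      frobSq_add (S - W0), frobSq_add S, finner_sub_right lam1 (Y - Xᵀ * S - U),
      finner_sub_right lam2 (V - S)]
    simp only [finner_sub_left, finner_mul_left]
    subst ha
    linear_combination h
  have hdiff : ∀ W, φ W = φ S + a / 2 * frobSq (W - S) + ρ / 2 * frobSq (Xᵀ * (W - S)) := by
    intro W
    rw [← key, add_sub_cancel]
  have hnonneg : ∀ W, 0 ≤ ρ / 2 * frobSq (Xᵀ * (W - S)) := fun W =>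
    mul_nonneg (by positivity) (frobSq_nonneg _)
  refine ⟨fun W => ?_, fun W hW => ?_⟩
  · have h := mul_nonneg (half_pos ha0).le (frobSq_nonneg (W - S))
    linarith [hdiff W, hnonneg W]
  · refine sub_eq_zero.mp (eq_zero_of_frobSq_nonpos ?_)
    refine nonpos_of_mul_nonpos_right ?_ (half_pos ha0)
    linarith [hdiff W, hnonneg W, hW S]
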